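/- Let b ≥ 1 be a natural number, α, β real numbers and γ a complex number with Re γ = 0 and D(α, β, γ, b) ≠ 0, and suppose the associated halfline interface coefficients 𝔞, 𝔟, 𝔠 satisfy Re 𝔠 ≠ 0. Then |2 + 𝔠|² + 𝔞𝔟 ≠ 0 and b = (|2 − 𝔠|² + 𝔞𝔟) / (|2 + 𝔠|² + 𝔞𝔟). In particular, the branching number b is uniquely determined by (𝔞, 𝔟, 𝔠). -/

import Mathlib

/-- Denominator `D(α, β, γ, b) = 4(√b + 1)² + (αβ + |γ|²)(√b − 1)² + 4(1 − b)·Re γ`. -/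
noncomputable def Dfun (α β : ℝ) (γ : ℂ) (b : ℕ) : ℝ :=
  4 * (Real.sqrt b + 1) ^ 2 + (α * β + Complex.normSq γ) * (Real.sqrt b - 1) ^ 2
    + 4 * (1 - (b : ℝ)) * γ.re

/-- Halfline interface coefficient `𝔞 = 16α / D`. -/
noncomputable def coefA (α β : ℝ) (γ : ℂ) (b : ℕ) : ℝ := 16 * α / Dfun α β γ b

/-- Halfline interface coefficient `𝔟 = 16 b β / D`. -/
noncomputable def coefB (α β : ℝ) (γ : ℂ) (b : ℕ) : ℝ := 16 * (b : ℝ) * β / Dfun α β γ b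

/-- Halfline interface coefficient
`𝔠 = 2[(1 − b)(4 + αβ + |γ|²) + 8 i √b · Im γ + 4(b + 1)·Re γ] / D`. -/
noncomputable def coefC (α β : ℝ) (γ : ℂ) (b : ℕ) : ℂ :=
  2 * ((1 - (b : ℂ)) * (4 + (α : ℂ) * (β : ℂ) + (Complex.normSq γ : ℂ))
      + 8 * Complex.I * ((Real.sqrt b : ℝ) : ℂ) * ((γ.im : ℝ) : ℂ)
      + 4 * ((b : ℂ) + 1) * ((γ.re : ℝ) : ℂ)) / ((Dfun α β γ b : ℝ) : ℂ)

lemma coefC_re_of_re_eq_zero {α β : ℝ} {γ : ℂ} {b : ℕ} (hγ : γ.re = 0) :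
    (coefC α β γ b).re =
      2 * ((1 - (b : ℝ)) * (4 + (α * β + Complex.normSq γ))) / Dfun α β γ b := by
  rw [coefC, Complex.div_ofReal_re, hγ]
  simp
  ring

lemma coefC_im_of_re_eq_zero {α β : ℝ} {γ : ℂ} {b : ℕ} (hγ : γ.re = 0) :
    (coefC α β γ b).im = 16 * Real.sqrt b * γ.im / Dfun α β γ b := by
  rw [coefC, Complex.div_ofReal_im, hγ]
  simp
  ring

lemma normSq_two_add_coefC_add {α β : ℝ} {γ : ℂ} {b : ℕ}
    (hγ : γ.re = 0) (hD : Dfun α β γ b ≠ 0) :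
    Complex.normSq (2 + coefC α β γ b) + coefA α β γ b * coefB α β γ b =
      16 * (4 + (α * β + Complex.normSq γ)) / Dfun α β γ b := by
  have hs : (b : ℝ) = Real.sqrt b ^ 2 := (Real.sq_sqrt b.cast_nonneg).symm
  rw [Complex.normSq_apply (2 + _), Complex.add_re, Complex.add_im, Complex.re_ofNat,
    Complex.im_ofNat, coefC_re_of_re_eq_zero hγ, coefC_im_of_re_eq_zero hγ, coefA, coefB]
  field_simp
  rw [Dfun, Complex.normSq_apply, hγ]
  generalize Real.sqrt b = s at hs ⊢
  rw [hs]
  ring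

lemma normSq_two_sub_coefC_add {α β : ℝ} {γ : ℂ} {b : ℕ}
    (hγ : γ.re = 0) (hD : Dfun α β γ b ≠ 0) :
    Complex.normSq (2 - coefC α β γ b) + coefA α β γ b * coefB α β γ b =
      b * (16 * (4 + (α * β + Complex.normSq γ)) / Dfun α β γ b) := by
  have hs : (b : ℝ) = Real.sqrt b ^ 2 := (Real.sq_sqrt b.cast_nonneg).symm
  rw [Complex.normSq_apply (2 - _), Complex.sub_re, Complex.sub_im, Complex.re_ofNat,
    Complex.im_ofNat, coefC_re_of_re_eq_zero hγ, coefC_im_of_re_eq_zero hγ, coefA, coefB]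
  field_simp
  rw [Dfun, Complex.normSq_apply, hγ]
  generalize Real.sqrt b = s at hs ⊢
  rw [hs]
  ring

/-- If `Re γ = 0`, `D ≠ 0` and `Re 𝔠 ≠ 0`, then `|2 + 𝔠|² + 𝔞𝔟 ≠ 0` and
`b = (|2 − 𝔠|² + 𝔞𝔟) / (|2 + 𝔠|² + 𝔞𝔟)`; in particular `b` is uniquely
determined by `(𝔞, 𝔟, 𝔠)`. -/
theorem stmt6 (α β : ℝ) (γ : ℂ) (b : ℕ) (hb : 1 ≤ b)
    (hγ : γ.re = 0) (hD : Dfun α β γ b ≠ 0)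
    (hc : (coefC α β γ b).re ≠ 0) :
    Complex.normSq (2 + coefC α β γ b) + coefA α β γ b * coefB α β γ b ≠ 0 ∧
    (b : ℝ) = (Complex.normSq (2 - coefC α β γ b) + coefA α β γ b * coefB α β γ b) /
        (Complex.normSq (2 + coefC α β γ b) + coefA α β γ b * coefB α β γ b) := by
  have hp : 4 + (α * β + Complex.normSq γ) ≠ 0 := by
    intro h
    rw [coefC_re_of_re_eq_zero hγ, h] at hc
    simp at hc
  have hN : 16 * (4 + (α * β + Complex.normSq γ)) / Dfun α β γ b ≠ 0 :=
    div_ne_zero (mul_ne_zero (by norm_num) hp) hD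
  rw [normSq_two_add_coefC_add hγ hD, normSq_two_sub_coefC_add hγ hD]
  exact ⟨hN, (mul_div_cancel_right₀ _ hN).symm⟩
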